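/- Let F_q be a finite field, m a prime with q primitive modulo m, s a divisor of m − 1 with s > 1, and r an integer of multiplicative order s modulo m. The number of tuples (a_1, …, a_{s−1}) in R_m^{s−1} (R_m = F_q[x]/(x^m−1)) satisfying a_1·μ_r(a_1)·⋯·μ_r^{s−1}(a_1) = 1 and a_j = a_1·μ_r(a_1)·⋯·μ_r^{j−1}(a_1) for 2 ≤ j ≤ s−1 is gcd(s, q−1)·(q^{m−1} − 1)/(q^{(m−1)/s} − 1). -/

import Mathlib

open Polynomial

/-- The multiplier map `μ_r : f(x) ↦ f(x^r)` on `R_m = F[x]/(x^m - 1)`, defined by lifting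
the evaluation at `x^r`. -/
noncomputable def muR (F : Type*) [Field F] (m r : ℕ) :
    (Polynomial F ⧸ Ideal.span {(X : Polynomial F) ^ m - 1}) →ₐ[F]
    (Polynomial F ⧸ Ideal.span {(X : Polynomial F) ^ m - 1}) :=
  Ideal.Quotient.liftₐ _
    (Polynomial.aeval ((Ideal.Quotient.mk (Ideal.span {(X : Polynomial F) ^ m - 1}) X) ^ r))
    (by
      intro a ha
      obtain ⟨c, rfl⟩ := (Ideal.mem_span_singleton.mp ha)
      have hX : (Ideal.Quotient.mk (Ideal.span {(X : Polynomial F) ^ m - 1}) X) ^ m = 1 := by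
        rw [← map_pow, ← map_one (Ideal.Quotient.mk (Ideal.span {(X : Polynomial F) ^ m - 1}))]
        rw [Ideal.Quotient.eq]
        exact Ideal.mem_span_singleton_self _
      simp only [map_mul, map_sub, map_pow, map_one, Polynomial.aeval_X]
      rw [← pow_mul, mul_comm r m, pow_mul, hX, one_pow, sub_self, zero_mul])

theorem ncard_pow_eq_one {K : Type*} [Field K] [Finite K] {n : ℕ} (hn : n ≠ 0) :
    Set.ncard {x : K | x ^ n = 1} = (Nat.card K - 1).gcd n := by
  rw [← Nat.card_units K, ← IsCyclic.card_powMonoidHom_ker, ← Nat.card_coe_set_eq]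
  refine (Nat.card_congr (Equiv.ofBijective
    (fun u : (powMonoidHom n : Kˣ →* Kˣ).ker ↦ (⟨(u : Kˣ), ?_⟩ : {x : K | x ^ n = 1}))
    ⟨?_, ?_⟩)).symm
  · have h := u.2
    rw [MonoidHom.mem_ker, powMonoidHom_apply] at h
    simpa using congrArg Units.val h
  · intro u v h
    exact Subtype.ext (Units.ext (congrArg Subtype.val h))
  · rintro ⟨x, hx⟩
    refine ⟨⟨Units.ofPowEqOne x n hx hn, ?_⟩, rfl⟩
    rw [MonoidHom.mem_ker, powMonoidHom_apply]
    exact Units.pow_ofPowEqOne hx hn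

theorem prod_range_pow_eq_of_orderOf_eq {R M : Type*} [CommRing R] [IsDomain R] [CommMonoid M]
    {a b : R} {n : ℕ} (hn : 0 < n) (ha : orderOf a = n) (hb : orderOf b = n) (g : R → M) :
    ∏ i ∈ Finset.range n, g (a ^ i) = ∏ i ∈ Finset.range n, g (b ^ i) := by
  classical
  have key : ∀ c : R, orderOf c = n →
      ∏ i ∈ Finset.range n, g (c ^ i) = ∏ x ∈ nthRootsFinset n (1 : R), g x := by
    intro c hc
    have hinj : Set.InjOn (fun i ↦ c ^ i) (Finset.range n : Set ℕ) := by
      rw [← hc, Finset.coe_range]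
      exact pow_injOn_Iio_orderOf
    have himage : (Finset.range n).image (fun i ↦ c ^ i) = nthRootsFinset n (1 : R) := by
      refine Finset.eq_of_subset_of_card_le ?_ ?_
      · intro x hx
        obtain ⟨i, -, rfl⟩ := Finset.mem_image.mp hx
        rw [mem_nthRootsFinset hn, ← pow_mul, mul_comm, pow_mul, ← hc, pow_orderOf_eq_one, one_pow]
      · rw [Finset.card_image_of_injOn hinj, Finset.card_range,
          (hc ▸ IsPrimitiveRoot.orderOf c : IsPrimitiveRoot c n).card_nthRootsFinset]
    rw [← himage, Finset.prod_image hinj]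
  rw [key a ha, key b hb]

theorem natCast_ne_zero_of_coprime_card {F : Type*} [Field F] [Fintype F] {m : ℕ}
    (h : (Fintype.card F).Coprime m) : (m : F) ≠ 0 := by
  have h' : IsCoprime ((Fintype.card F : ℤ) : F) ((m : ℤ) : F) :=
    (Nat.isCoprime_iff_coprime.mpr h).map (Int.castRingHom F)
  simpa using h'

theorem irreducible_cyclotomic_of_orderOf_card {F : Type*} [Field F] [Fintype F] {m : ℕ}
    [hm : Fact m.Prime] (h : (Fintype.card F).Coprime m)
    (hprim : orderOf (Fintype.card F : ZMod m) = m - 1) : Irreducible (cyclotomic m F) := by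
  obtain ⟨p, n, hp, hn⟩ : ∃ (p : ℕ) (n : ℕ+), p.Prime ∧ Fintype.card F = p ^ (n : ℕ) := by
    obtain ⟨p, _⟩ := CharP.exists F
    exact ⟨p, FiniteField.card F p⟩
  have : Fact p.Prime := ⟨hp⟩
  rw [hn] at h hprim
  refine irreducible_of_dvd_cyclotomic_of_natDegree hn
    ((Nat.coprime_pow_left_iff n.pos _ _).mp h) dvd_rfl ?_
  rw [natDegree_cyclotomic, Nat.totient_prime hm.out, ← orderOf_units, ZMod.coe_unitOfCoprime,
    hprim]

theorem isCoprime_X_sub_one_cyclotomic_prime {F : Type*} [Field F] {m : ℕ} [Fact m.Prime]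
    (h : (m : F) ≠ 0) : IsCoprime (X - 1 : F[X]) (cyclotomic m F) := by
  have hirr : Irreducible (X - 1 : F[X]) := by simpa using irreducible_X_sub_C (1 : F)
  rw [hirr.coprime_iff_not_dvd]
  intro hdvd
  rw [← C_1, dvd_iff_isRoot, IsRoot.def, eval_one_cyclotomic_prime] at hdvd
  exact h hdvd

theorem muR_iterate_mk {F : Type*} [Field F] (m r i : ℕ) (f : F[X]) :
    (⇑(muR F m r))^[i] (Ideal.Quotient.mk _ f) = Ideal.Quotient.mk _ (expand F (r ^ i) f) := by
  induction i with
  | zero => simp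
  | succ i ih =>
    rw [Function.iterate_succ_apply', ih, pow_succ', ← expand_expand]
    set g := expand F (r ^ i) f
    change aeval (Ideal.Quotient.mk _ X ^ r) g = Ideal.Quotient.mkₐ F _ (aeval (X ^ r) g)
    rw [← aeval_algHom_apply, map_pow]
    rfl

theorem prod_aeval_pow_pow_eq {F K : Type*} [Field F] [Fintype F] [Field K] [Algebra F K]
    {m s r d : ℕ} [Fact m.Prime] (hs : 0 < s) (hr : orderOf (r : ZMod m) = s)
    (hd : orderOf ((Fintype.card F : ZMod m) ^ d) = s) {z : K} (hz : z ^ m = 1) (f : F[X]) :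
    ∏ i ∈ Finset.range s, aeval (z ^ r ^ i) f =
      aeval z f ^ ∑ i ∈ Finset.range s, (Fintype.card F ^ d) ^ i := by
  have hfrob : ∀ n : ℕ, aeval (z ^ Fintype.card F ^ n) f = aeval z f ^ Fintype.card F ^ n := by
    intro n
    induction n with
    | zero => simp
    | succ n ih =>
      rw [pow_succ, pow_mul, ← expand_aeval, FiniteField.expand_card, map_pow, ih, ← pow_mul]
  have hval : ∀ n : ℕ, z ^ (n : ZMod m).val = z ^ n := fun n ↦ by
    rw [ZMod.val_natCast, ← pow_eq_pow_mod n hz]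
  have key := prod_range_pow_eq_of_orderOf_eq hs hr hd fun c : ZMod m ↦ aeval (z ^ c.val) f
  simp only [← Nat.cast_pow, hval] at key
  simp only [key, ← pow_mul, hfrob, Finset.prod_pow_eq_pow_sum]

/-- Evaluation of `R_m = F[x]/(x^m - 1)` at an `m`-th root of unity `z`. -/
noncomputable def evalRootOfUnity {F K : Type*} [Field F] [Field K] [Algebra F K] {m : ℕ}
    {z : K} (hz : z ^ m = 1) : (F[X] ⧸ Ideal.span {(X : F[X]) ^ m - 1}) →ₐ[F] K :=
  Ideal.Quotient.liftₐ _ (aeval z) fun a ha ↦ by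
    obtain ⟨c, rfl⟩ := Ideal.mem_span_singleton.mp ha
    simp [hz]

theorem evalRootOfUnity_mk {F K : Type*} [Field F] [Field K] [Algebra F K] {m : ℕ}
    {z : K} (hz : z ^ m = 1) (f : F[X]) :
    evalRootOfUnity hz (Ideal.Quotient.mk _ f) = aeval z f := rfl

theorem evalRootOfUnity_prod_muR {F K : Type*} [Field F] [Field K] [Algebra F K] {m : ℕ}
    {z : K} (hz : z ^ m = 1) (r s : ℕ) (f : F[X]) :
    evalRootOfUnity hz (∏ i ∈ Finset.range s, (⇑(muR F m r))^[i] (Ideal.Quotient.mk _ f)) =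
      ∏ i ∈ Finset.range s, aeval (z ^ r ^ i) f := by
  simp only [map_prod, muR_iterate_mk, evalRootOfUnity_mk, expand_aeval]

theorem root_cyclotomic_pow_eq_one (F : Type*) [Field F] (m : ℕ) :
    (AdjoinRoot.root (cyclotomic m F)) ^ m = 1 := by
  have h : AdjoinRoot.mk (cyclotomic m F) (X ^ m - 1) = 0 :=
    AdjoinRoot.mk_eq_zero.mpr (cyclotomic.dvd_X_pow_sub_one m F)
  simpa [sub_eq_zero] using h

theorem bijective_eval_one_eval_root {F : Type*} [Field F] {m : ℕ} [hm : Fact m.Prime]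
    [Fact (Irreducible (cyclotomic m F))] (h : (m : F) ≠ 0) :
    Function.Bijective fun x : F[X] ⧸ Ideal.span {(X : F[X]) ^ m - 1} ↦
      (evalRootOfUnity (one_pow m : (1 : F) ^ m = 1) x,
        evalRootOfUnity (root_cyclotomic_pow_eq_one F m) x) := by
  have hcop := isCoprime_X_sub_one_cyclotomic_prime h
  constructor
  · change Function.Injective ((evalRootOfUnity (one_pow m : (1 : F) ^ m = 1)).prod
      (evalRootOfUnity (root_cyclotomic_pow_eq_one F m)))
    rw [injective_iff_map_eq_zero]
    intro x hx
    obtain ⟨f, rfl⟩ := Ideal.Quotient.mk_surjective x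
    rw [AlgHom.prod_apply, Prod.mk_eq_zero, evalRootOfUnity_mk, evalRootOfUnity_mk,
      AdjoinRoot.aeval_eq, AdjoinRoot.mk_eq_zero, coe_aeval_eq_eval, ← IsRoot.def,
      ← dvd_iff_isRoot, C_1] at hx
    rw [Ideal.Quotient.eq_zero_iff_mem, Ideal.mem_span_singleton,
      ← cyclotomic_prime_mul_X_sub_one F m, mul_comm]
    exact hcop.mul_dvd hx.1 hx.2
  · rintro ⟨a, b⟩
    obtain ⟨g, rfl⟩ := AdjoinRoot.mk_surjective b
    obtain ⟨u, v, huv⟩ := hcop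
    refine ⟨Ideal.Quotient.mk _
      (C a * (v * cyclotomic m F) + g * (u * (X - 1))), ?_⟩
    simp only [evalRootOfUnity_mk, Prod.mk.injEq]
    constructor
    · have h1 := congrArg (aeval (1 : F)) huv
      simp only [map_add, map_mul, map_sub, map_one, aeval_X, sub_self, mul_zero, zero_add] at h1
      rw [map_add, map_mul, map_mul, map_mul, map_mul, h1]
      simp
    · have h2 := congrArg (AdjoinRoot.mk (cyclotomic m F)) huv
      simp only [map_add, map_mul, AdjoinRoot.mk_self, mul_zero, add_zero, map_one] at h2
      simp only [AdjoinRoot.aeval_eq, map_add, map_mul, AdjoinRoot.mk_self, mul_zero, zero_add, h2,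
        mul_one]

theorem orderOf_pow_div {G : Type*} [Monoid G] {a : G} {n s : ℕ} (ha : orderOf a = n)
    (hn : n ≠ 0) (hs : s ∣ n) : orderOf (a ^ (n / s)) = s := by
  rw [orderOf_pow_of_dvd (Nat.div_pos (Nat.le_of_dvd (by omega) hs)
    (Nat.pos_of_dvd_of_pos hs (by omega))).ne' (ha.symm ▸ Nat.div_dvd_of_dvd hs), ha,
    Nat.div_div_self hs hn]

theorem ncard_prod_muR_eq_one {F : Type*} [Field F] [Fintype F] {m s r : ℕ}
    [hm : Fact m.Prime] (hcop : (Fintype.card F).Coprime m)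
    (hprim : orderOf (Fintype.card F : ZMod m) = m - 1)
    (hs : 0 < s) (hsm : s ∣ m - 1) (hr : orderOf (r : ZMod m) = s) :
    Set.ncard {x : F[X] ⧸ Ideal.span {(X : F[X]) ^ m - 1} |
        ∏ i ∈ Finset.range s, (⇑(muR F m r))^[i] x = 1} =
      Nat.gcd s (Fintype.card F - 1) *
        ((Fintype.card F ^ (m - 1) - 1) / (Fintype.card F ^ ((m - 1) / s) - 1)) := by
  have hirr := irreducible_cyclotomic_of_orderOf_card hcop hprim
  have : Fact (Irreducible (cyclotomic m F)) := ⟨hirr⟩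
  have hm1 : m - 1 ≠ 0 := (Nat.sub_pos_of_lt hm.out.one_lt).ne'
  set q := Fintype.card F with hq
  set d := (m - 1) / s with hd
  have hds : d * s = m - 1 := Nat.div_mul_cancel hsm
  have hd0 : d ≠ 0 := fun h ↦ hm1 (by rw [← hds, h, zero_mul])
  have hqd : 2 ≤ q ^ d := (Fintype.one_lt_card (α := F)).trans_le (Nat.le_self_pow hd0 q)
  set N := ∑ i ∈ Finset.range s, (q ^ d) ^ i with hN
  have hNeq : N = (q ^ (m - 1) - 1) / (q ^ d - 1) := by rw [hN, Nat.geomSum_eq hqd, ← pow_mul, hds]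
  have hNdvd : N ∣ q ^ (m - 1) - 1 :=
    ⟨q ^ d - 1, by rw [hN, Nat.geomSum_eq hqd, ← pow_mul, hds,
      Nat.div_mul_cancel (by rw [← hds, pow_mul]; exact Nat.sub_one_dvd_pow_sub_one _ _)]⟩
  have hN0 : N ≠ 0 := fun h ↦ by
    have h1 : 1 < q ^ (m - 1) := Nat.one_lt_pow hm1 Fintype.one_lt_card
    rw [h, zero_dvd_iff] at hNdvd
    omega
  have hfin : Module.Finite F (AdjoinRoot (cyclotomic m F)) :=
    (cyclotomic.monic m F).finite_adjoinRoot
  have : Finite (AdjoinRoot (cyclotomic m F)) := Module.finite_of_finite F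
  have hcard : Nat.card (AdjoinRoot (cyclotomic m F)) = q ^ (m - 1) := by
    rw [Module.natCard_eq_pow_finrank (K := F), Nat.card_eq_fintype_card,
      (AdjoinRoot.powerBasis hirr.ne_zero).finrank, AdjoinRoot.powerBasis_dim,
      natDegree_cyclotomic, Nat.totient_prime hm.out]
  have hbij := bijective_eval_one_eval_root (F := F) (m := m)
    (natCast_ne_zero_of_coprime_card hcop)
  have hpre : {x : F[X] ⧸ Ideal.span {(X : F[X]) ^ m - 1} |
      ∏ i ∈ Finset.range s, (⇑(muR F m r))^[i] x = 1} =
      (Equiv.ofBijective _ hbij) ⁻¹'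
        ({a : F | a ^ s = 1} ×ˢ {b : AdjoinRoot (cyclotomic m F) | b ^ N = 1}) := by
    ext x
    obtain ⟨f, rfl⟩ := Ideal.Quotient.mk_surjective x
    rw [Set.mem_ofPred_eq, ← hbij.1.eq_iff]
    simp only [Set.mem_preimage, Set.mem_prod, Set.mem_ofPred_eq, Equiv.ofBijective_apply,
      evalRootOfUnity_prod_muR, map_one, Prod.mk.injEq, one_pow, Finset.prod_const,
      Finset.card_range, evalRootOfUnity_mk]
    rw [prod_aeval_pow_pow_eq hs hr (orderOf_pow_div hprim hm1 hsm)
      (root_cyclotomic_pow_eq_one F m)]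
  rw [hpre, Set.ncard_preimage_of_injective_subset_range (Equiv.injective _)
    (by rw [(Equiv.surjective _).range_eq]; exact Set.subset_univ _), Set.ncard_prod, ncard_pow_eq_one hs.ne', ncard_pow_eq_one hN0, hcard,
    Nat.gcd_eq_right hNdvd, hNeq, Nat.card_eq_fintype_card, Nat.gcd_comm]

/-- Lemma 3 (count): the number of tuples `(a_1, …, a_{s-1})` in `R_m^{s-1}` with
`a_1 μ_r(a_1) ⋯ μ_r^{s-1}(a_1) = 1` and `a_j = a_1 μ_r(a_1) ⋯ μ_r^{j-1}(a_1)` is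
`gcd(s, q-1) · (q^{m-1} - 1)/(q^{(m-1)/s} - 1)`. -/
theorem count_circulant_metacyclic (F : Type*) [Field F] [Fintype F] (m s r : ℕ)
    [hm : Fact m.Prime] (hdvdq : ¬ m ∣ Fintype.card F)
    (hprim : orderOf ((Fintype.card F : ZMod m)) = m - 1)
    (hs1 : 1 < s) (hsm : s ∣ m - 1)
    (hr : orderOf ((r : ZMod m)) = s) :
    Set.ncard {a : Fin (s - 1) → (Polynomial F ⧸ Ideal.span {(X : Polynomial F) ^ m - 1}) |
        (∏ i ∈ Finset.range s, (⇑(muR F m r))^[i] (a ⟨0, by omega⟩)) = 1 ∧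
        ∀ j : Fin (s - 1),
          a j = ∏ i ∈ Finset.range ((j : ℕ) + 1), (⇑(muR F m r))^[i] (a ⟨0, by omega⟩)} =
      Nat.gcd s (Fintype.card F - 1) *
        ((Fintype.card F ^ (m - 1) - 1) / (Fintype.card F ^ ((m - 1) / s) - 1)) := by
  have hpos : 0 < s - 1 := by omega
  have hcop : (Fintype.card F).Coprime m :=
    ((Nat.Prime.coprime_iff_not_dvd hm.out).mpr hdvdq).symm
  rw [← ncard_prod_muR_eq_one hcop hprim (by omega) hsm hr]
  refine Set.ncard_congr (fun a _ ↦ a ⟨0, hpos⟩) (fun a ha ↦ ha.1) ?_ ?_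
  · intro a b ha hb hab
    funext j
    rw [ha.2 j, hb.2 j, hab]
  · intro x hx
    refine ⟨fun j ↦ ∏ i ∈ Finset.range ((j : ℕ) + 1), (⇑(muR F m r))^[i] x, ⟨?_, fun j ↦ ?_⟩, ?_⟩
    · simpa using hx
    · simp
    · simp
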